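/- arXiv:1406.2520 — 2 statements merged into one kernel-verified Lean document; each statement's English description precedes it below -/
import Mathlib

section
/- Let (Ȳ_1, Ȳ_2) be a jointly Gaussian pair of random vectors as above, with each Ȳ_α standard Gaussian and cross-correlation matrix R = (E[Y_{1,i} Y_{2,j}])_{i,j}, and let s* be the largest singular value of R. Then for every ε > 0 there exist centered square-integrable functions φ_1, φ_2 (of Ȳ_1, Ȳ_2 respectively, not both a.s. zero) with ‖φ_1(Ȳ_1) + φ_2(Ȳ_2)‖_2^2 ≥ (1 + s* − ε)(‖φ_1(Ȳ_1)‖_2^2 + ‖φ_2(Ȳ_2)‖_2^2), and there exist such functions with ‖φ_1(Ȳ_1) + φ_2(Ȳ_2)‖_2^2 ≤ (1 − s* + ε)(‖φ_1(Ȳ_1)‖_2^2 + ‖φ_2(Ȳ_2)‖_2^2). That is, the constants 1 ± s* cannot be improved. -/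
open MeasureTheory ProbabilityTheory
open scoped NNReal

/-- `(Y₁, Y₂)` is a jointly centered Gaussian pair of random vectors: every linear combination
of all their coordinates has a centered Gaussian law. -/
def IsJointGaussianPair {Ω : Type*} [MeasurableSpace Ω] (μ : Measure Ω) {d₁ d₂ : ℕ}
    (Y₁ : Ω → Fin d₁ → ℝ) (Y₂ : Ω → Fin d₂ → ℝ) : Prop :=
  ∀ (c₁ : Fin d₁ → ℝ) (c₂ : Fin d₂ → ℝ), ∃ v : ℝ≥0,
    Measure.map (fun ω => ∑ i, c₁ i * Y₁ ω i + ∑ j, c₂ j * Y₂ ω j) μ = gaussianReal 0 v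

namespace IsJointGaussianPair

variable {Ω : Type*} [MeasurableSpace Ω] {μ : Measure Ω} {d₁ d₂ : ℕ}
  {Y₁ : Ω → Fin d₁ → ℝ} {Y₂ : Ω → Fin d₂ → ℝ}

theorem memLp_two_linear (h : IsJointGaussianPair μ Y₁ Y₂)
    (c₁ : Fin d₁ → ℝ) (c₂ : Fin d₂ → ℝ) :
    MemLp (fun ω => ∑ i, c₁ i * Y₁ ω i + ∑ j, c₂ j * Y₂ ω j) 2 μ := by
  obtain ⟨v, hv⟩ := h c₁ c₂
  have hm : AEMeasurable (fun ω => ∑ i, c₁ i * Y₁ ω i + ∑ j, c₂ j * Y₂ ω j) μ := by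
    refine AEMeasurable.of_map_ne_zero ?_
    rw [hv]
    exact IsProbabilityMeasure.ne_zero _
  have hid : MemLp id 2 (Measure.map
      (fun ω => ∑ i, c₁ i * Y₁ ω i + ∑ j, c₂ j * Y₂ ω j) μ) := by
    rw [hv]
    exact memLp_id_gaussianReal 2
  exact hid.comp_of_map hm

theorem memLp_two_left (h : IsJointGaussianPair μ Y₁ Y₂) (i : Fin d₁) :
    MemLp (fun ω => Y₁ ω i) 2 μ := by
  simpa [Pi.single_apply] using h.memLp_two_linear (Pi.single i 1) 0

theorem memLp_two_right (h : IsJointGaussianPair μ Y₁ Y₂) (j : Fin d₂) :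
    MemLp (fun ω => Y₂ ω j) 2 μ := by
  simpa [Pi.single_apply] using h.memLp_two_linear 0 (Pi.single j 1)

end IsJointGaussianPair

theorem MeasureTheory.MemLp.dotProduct {Ω ι : Type*} [MeasurableSpace Ω] {μ : Measure Ω}
    [Fintype ι] {p : ENNReal} {X : Ω → ι → ℝ} (hX : ∀ i, MemLp (fun ω => X ω i) p μ)
    (a : ι → ℝ) : MemLp (fun ω => a ⬝ᵥ X ω) p μ :=
  memLp_finsetSum Finset.univ fun i _ => (hX i).const_mul (a i)

theorem integral_dotProduct_mul_dotProduct {Ω ι κ : Type*} [MeasurableSpace Ω] {μ : Measure Ω}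
    [Fintype ι] [Fintype κ] {X : Ω → ι → ℝ} {Z : Ω → κ → ℝ}
    (hX : ∀ i, MemLp (fun ω => X ω i) 2 μ) (hZ : ∀ j, MemLp (fun ω => Z ω j) 2 μ)
    (a : ι → ℝ) (b : κ → ℝ) :
    ∫ ω, (a ⬝ᵥ X ω) * (b ⬝ᵥ Z ω) ∂μ =
      a ⬝ᵥ (Matrix.of fun i j => ∫ ω, X ω i * Z ω j ∂μ).mulVec b := by
  have hint (i : ι) (j : κ) : Integrable (fun ω => a i * b j * (X ω i * Z ω j)) μ :=
    ((hX i).integrable_mul (hZ j)).const_mul _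
  calc
    _ = ∫ ω, ∑ i, ∑ j, a i * b j * (X ω i * Z ω j) ∂μ := by
      refine integral_congr_ae (.of_forall fun ω => ?_)
      simp only [dotProduct, Finset.sum_mul_sum]
      exact Finset.sum_congr rfl fun i _ => Finset.sum_congr rfl fun j _ => by ring
    _ = ∑ i, ∑ j, a i * b j * ∫ ω, X ω i * Z ω j ∂μ := by
      rw [integral_finsetSum _ fun i _ => integrable_finsetSum _ fun j _ => hint i j]
      refine Finset.sum_congr rfl fun i _ => ?_
      rw [integral_finsetSum _ fun j _ => hint i j]
      exact Finset.sum_congr rfl fun j _ => integral_const_mul _ _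
    _ = _ := by
      simp only [dotProduct, Matrix.mulVec, Matrix.of_apply, Finset.mul_sum]
      exact Finset.sum_congr rfl fun i _ => Finset.sum_congr rfl fun j _ => by ring

theorem integral_dotProduct_sq {Ω ι : Type*} [MeasurableSpace Ω] {μ : Measure Ω}
    [Fintype ι] [DecidableEq ι] {X : Ω → ι → ℝ} (hX : ∀ i, MemLp (fun ω => X ω i) 2 μ)
    (hcov : ∀ i j, ∫ ω, X ω i * X ω j ∂μ = if i = j then 1 else 0) (a : ι → ℝ) :
    ∫ ω, (a ⬝ᵥ X ω) ^ 2 ∂μ = a ⬝ᵥ a := by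
  have hone : (Matrix.of fun i j => ∫ ω, X ω i * X ω j ∂μ) = 1 := by
    ext i j
    simp [hcov, Matrix.one_apply]
  simp only [pow_two, integral_dotProduct_mul_dotProduct hX hX, hone, Matrix.one_mulVec]

theorem integral_dotProduct_eq_zero {Ω ι : Type*} [MeasurableSpace Ω] {μ : Measure Ω}
    [IsFiniteMeasure μ] [Fintype ι] {X : Ω → ι → ℝ} (hX : ∀ i, MemLp (fun ω => X ω i) 2 μ)
    (hmean : ∀ i, ∫ ω, X ω i ∂μ = 0) (a : ι → ℝ) : ∫ ω, a ⬝ᵥ X ω ∂μ = 0 := by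
  simp only [dotProduct]
  rw [integral_finsetSum _ fun i _ => ((hX i).integrable one_le_two).const_mul (a i)]
  simp [integral_const_mul, hmean]

/-- Linear forms along a pair of singular vectors attain the constant `1 + σ * s`, where
`σ` is a sign. -/
theorem exists_linear_forms_attaining_constant
    {Ω : Type*} [MeasurableSpace Ω] {μ : Measure Ω} [IsProbabilityMeasure μ]
    {d₁ d₂ : ℕ} {Y₁ : Ω → Fin d₁ → ℝ} {Y₂ : Ω → Fin d₂ → ℝ}
    (hGauss : IsJointGaussianPair μ Y₁ Y₂)
    (hmean₁ : ∀ i, ∫ ω, Y₁ ω i ∂μ = 0)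
    (hmean₂ : ∀ j, ∫ ω, Y₂ ω j ∂μ = 0)
    (hcov₁ : ∀ i j, ∫ ω, Y₁ ω i * Y₁ ω j ∂μ = if i = j then 1 else 0)
    (hcov₂ : ∀ i j, ∫ ω, Y₂ ω i * Y₂ ω j ∂μ = if i = j then 1 else 0)
    {R : Matrix (Fin d₁) (Fin d₂) ℝ}
    (hR : ∀ i j, R i j = ∫ ω, Y₁ ω i * Y₂ ω j ∂μ)
    {s : ℝ} {v : Fin d₂ → ℝ} (hv : v ≠ 0) (hRv : (R.transpose * R).mulVec v = s ^ 2 • v)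
    {σ : ℝ} (hσ : σ ^ 2 = 1) :
    ∃ (φ₁ : (Fin d₁ → ℝ) → ℝ) (φ₂ : (Fin d₂ → ℝ) → ℝ),
      Measurable φ₁ ∧ Measurable φ₂ ∧
      (∫ ω, φ₁ (Y₁ ω) ∂μ = 0) ∧ (∫ ω, φ₂ (Y₂ ω) ∂μ = 0) ∧
      Integrable (fun ω => (φ₁ (Y₁ ω)) ^ 2) μ ∧
      Integrable (fun ω => (φ₂ (Y₂ ω)) ^ 2) μ ∧
      0 < (∫ ω, (φ₁ (Y₁ ω)) ^ 2 ∂μ) + ∫ ω, (φ₂ (Y₂ ω)) ^ 2 ∂μ ∧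
      ∫ ω, (φ₁ (Y₁ ω) + φ₂ (Y₂ ω)) ^ 2 ∂μ =
        (1 + σ * s) * ((∫ ω, (φ₁ (Y₁ ω)) ^ 2 ∂μ) + ∫ ω, (φ₂ (Y₂ ω)) ^ 2 ∂μ) := by
  have h₁ := hGauss.memLp_two_left
  have h₂ := hGauss.memLp_two_right
  have hnorm : R.mulVec v ⬝ᵥ R.mulVec v = s ^ 2 * (v ⬝ᵥ v) := by
    rw [Matrix.dotProduct_mulVec, ← Matrix.mulVec_transpose, Matrix.mulVec_mulVec, hRv,
      smul_dotProduct, smul_eq_mul]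
  have hpos : 0 < v ⬝ᵥ v := by
    refine lt_of_le_of_ne (Finset.sum_nonneg fun i _ => mul_self_nonneg (v i)) fun h => hv ?_
    exact dotProduct_self_eq_zero.mp h.symm
  have hcross (a : Fin d₁ → ℝ) :
      ∫ ω, (a ⬝ᵥ Y₁ ω) * (v ⬝ᵥ Y₂ ω) ∂μ = a ⬝ᵥ R.mulVec v := by
    rw [integral_dotProduct_mul_dotProduct h₁ h₂]
    congr
    ext i j
    exact (hR i j).symm
  -- When `s = 0` the first form vanishes, since `0⁻¹ = 0`.
  set a : Fin d₁ → ℝ := (σ * s⁻¹) • R.mulVec v with ha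
  have hL₁ : MemLp (fun ω => a ⬝ᵥ Y₁ ω) 2 μ := MemLp.dotProduct h₁ a
  have hL₂ : MemLp (fun ω => v ⬝ᵥ Y₂ ω) 2 μ := MemLp.dotProduct h₂ v
  have hsq₁ := integral_dotProduct_sq h₁ hcov₁ a
  have hsq₂ := integral_dotProduct_sq h₂ hcov₂ v
  have haa : a ⬝ᵥ a = (s⁻¹ * s) ^ 2 * (v ⬝ᵥ v) := by
    rw [ha, smul_dotProduct, dotProduct_smul, hnorm, smul_eq_mul, smul_eq_mul]
    linear_combination s⁻¹ ^ 2 * s ^ 2 * (v ⬝ᵥ v) * hσ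
  have hav : a ⬝ᵥ R.mulVec v = σ * s * (v ⬝ᵥ v) := by
    rw [ha, smul_dotProduct, hnorm, smul_eq_mul]
    rcases eq_or_ne s 0 with rfl | hs
    · simp
    · field_simp
  refine ⟨fun y => a ⬝ᵥ y, fun y => v ⬝ᵥ y, ?_, ?_, integral_dotProduct_eq_zero h₁ hmean₁ a,
    integral_dotProduct_eq_zero h₂ hmean₂ v, hL₁.integrable_sq, hL₂.integrable_sq, ?_, ?_⟩
  · unfold dotProduct; fun_prop
  · unfold dotProduct; fun_prop
  · rw [hsq₁, hsq₂, haa]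
    positivity
  · have hexp : ∫ ω, (a ⬝ᵥ Y₁ ω + v ⬝ᵥ Y₂ ω) ^ 2 ∂μ =
        a ⬝ᵥ a + v ⬝ᵥ v + 2 * (a ⬝ᵥ R.mulVec v) := by
      have hmul : Integrable (fun ω => 2 * ((a ⬝ᵥ Y₁ ω) * (v ⬝ᵥ Y₂ ω))) μ :=
        (hL₁.integrable_mul hL₂).const_mul 2
      have hsum : Integrable (fun ω => (a ⬝ᵥ Y₁ ω) ^ 2 + (v ⬝ᵥ Y₂ ω) ^ 2) μ :=
        hL₁.integrable_sq.add hL₂.integrable_sq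
      rw [← hcross a, ← hsq₁, ← hsq₂, ← integral_const_mul,
        ← integral_add hL₁.integrable_sq hL₂.integrable_sq, ← integral_add hsum hmul]
      exact integral_congr_ae (.of_forall fun ω => by ring)
    rw [hexp, hsq₁, hsq₂, haa, hav]
    rcases eq_or_ne s 0 with rfl | hs
    · simp
    · rw [inv_mul_cancel₀ hs]; ring

/-- **Sharpness of the two-vector decoupling constants `1 ± s`.** For every `ε > 0` there are
centered square-integrable functions (not both a.s. zero) nearly attaining the upper constant
`1 + s`, and there are such functions nearly attaining the lower constant `1 - s`. -/
theorem decoupling_two_gaussian_vectors_sharp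
    {Ω : Type*} [MeasurableSpace Ω] (μ : Measure Ω) [IsProbabilityMeasure μ]
    {d₁ d₂ : ℕ} (Y₁ : Ω → Fin d₁ → ℝ) (Y₂ : Ω → Fin d₂ → ℝ)
    (hGauss : IsJointGaussianPair μ Y₁ Y₂)
    (hmean₁ : ∀ i, ∫ ω, Y₁ ω i ∂μ = 0)
    (hmean₂ : ∀ j, ∫ ω, Y₂ ω j ∂μ = 0)
    (hcov₁ : ∀ i j, ∫ ω, Y₁ ω i * Y₁ ω j ∂μ = if i = j then 1 else 0)
    (hcov₂ : ∀ i j, ∫ ω, Y₂ ω i * Y₂ ω j ∂μ = if i = j then 1 else 0)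
    (R : Matrix (Fin d₁) (Fin d₂) ℝ)
    (hR : ∀ i j, R i j = ∫ ω, Y₁ ω i * Y₂ ω j ∂μ)
    (s : ℝ) (hs0 : 0 ≤ s)
    (hsEig : ∃ v : Fin d₂ → ℝ, v ≠ 0 ∧ (R.transpose * R).mulVec v = s ^ 2 • v)
    (hsMax : ∀ (t : ℝ) (v : Fin d₂ → ℝ), v ≠ 0 → (R.transpose * R).mulVec v = t • v →
      t ≤ s ^ 2)
    (ε : ℝ) (hε : 0 < ε) :
    (∃ (φ₁ : (Fin d₁ → ℝ) → ℝ) (φ₂ : (Fin d₂ → ℝ) → ℝ),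
      Measurable φ₁ ∧ Measurable φ₂ ∧
      (∫ ω, φ₁ (Y₁ ω) ∂μ = 0) ∧ (∫ ω, φ₂ (Y₂ ω) ∂μ = 0) ∧
      Integrable (fun ω => (φ₁ (Y₁ ω)) ^ 2) μ ∧
      Integrable (fun ω => (φ₂ (Y₂ ω)) ^ 2) μ ∧
      0 < (∫ ω, (φ₁ (Y₁ ω)) ^ 2 ∂μ) + ∫ ω, (φ₂ (Y₂ ω)) ^ 2 ∂μ ∧
      (1 + s - ε) * ((∫ ω, (φ₁ (Y₁ ω)) ^ 2 ∂μ) + ∫ ω, (φ₂ (Y₂ ω)) ^ 2 ∂μ) ≤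
        ∫ ω, (φ₁ (Y₁ ω) + φ₂ (Y₂ ω)) ^ 2 ∂μ) ∧
    (∃ (φ₁ : (Fin d₁ → ℝ) → ℝ) (φ₂ : (Fin d₂ → ℝ) → ℝ),
      Measurable φ₁ ∧ Measurable φ₂ ∧
      (∫ ω, φ₁ (Y₁ ω) ∂μ = 0) ∧ (∫ ω, φ₂ (Y₂ ω) ∂μ = 0) ∧
      Integrable (fun ω => (φ₁ (Y₁ ω)) ^ 2) μ ∧
      Integrable (fun ω => (φ₂ (Y₂ ω)) ^ 2) μ ∧
      0 < (∫ ω, (φ₁ (Y₁ ω)) ^ 2 ∂μ) + ∫ ω, (φ₂ (Y₂ ω)) ^ 2 ∂μ ∧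
      ∫ ω, (φ₁ (Y₁ ω) + φ₂ (Y₂ ω)) ^ 2 ∂μ ≤
        (1 - s + ε) * ((∫ ω, (φ₁ (Y₁ ω)) ^ 2 ∂μ) + ∫ ω, (φ₂ (Y₂ ω)) ^ 2 ∂μ)) := by
  obtain ⟨v, hv, hRv⟩ := hsEig
  constructor
  · obtain ⟨φ₁, φ₂, hφ₁, hφ₂, hz₁, hz₂, hi₁, hi₂, hpos, heq⟩ :=
      exists_linear_forms_attaining_constant hGauss hmean₁ hmean₂ hcov₁ hcov₂ hR hv hRv
        (σ := 1) (by norm_num)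
    refine ⟨φ₁, φ₂, hφ₁, hφ₂, hz₁, hz₂, hi₁, hi₂, hpos, ?_⟩
    rw [heq]
    exact mul_le_mul_of_nonneg_right (by linarith) hpos.le
  · obtain ⟨φ₁, φ₂, hφ₁, hφ₂, hz₁, hz₂, hi₁, hi₂, hpos, heq⟩ :=
      exists_linear_forms_attaining_constant hGauss hmean₁ hmean₂ hcov₁ hcov₂ hR hv hRv
        (σ := -1) (by norm_num)
    refine ⟨φ₁, φ₂, hφ₁, hφ₂, hz₁, hz₂, hi₁, hi₂, hpos, ?_⟩
    rw [heq]
    exact mul_le_mul_of_nonneg_right (by linarith) hpos.le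
end

section
/- Let Ȳ_1, …, Ȳ_N be jointly Gaussian random vectors, each Ȳ_α standard Gaussian in R^{d_α}, with cross-correlation matrices R^{α,β} = (E[Y_{α,i} Y_{β,j}])_{i,j} for α ≠ β. With s*_{α,β} the largest singular value of R^{α,β} (and s*_{α,α} = 0) and σ_0 the largest eigenvalue of S* = (s*_{α,β}), the upper decoupling bound ‖Σ_{α=1}^N φ_α(Ȳ_α)‖_2^2 ≤ (1 + σ_0) Σ_{α=1}^N ‖φ_α(Ȳ_α)‖_2^2 holds for all measurable φ_α : R^{d_α} → R with E[φ_α(Ȳ_α)] = 0 and φ_α(Ȳ_α) square-integrable. -/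
open MeasureTheory ProbabilityTheory
open scoped NNReal

/-- A family of random vectors `Y α : Ω → Fin (d α) → ℝ` is jointly centered Gaussian if every
linear combination of all their coordinates has a centered Gaussian law. -/
def IsJointGaussianFamily {Ω : Type*} [MeasurableSpace Ω] (μ : Measure Ω) {N : ℕ}
    {d : Fin N → ℕ} (Y : (α : Fin N) → Ω → Fin (d α) → ℝ) : Prop :=
  ∀ c : (α : Fin N) → Fin (d α) → ℝ, ∃ v : ℝ≥0,
    Measure.map (fun ω => ∑ α, ∑ i, c α i * Y α ω i) μ = gaussianReal 0 v

section

open Matrix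

theorem Matrix.PosSemidef.sum_mul_pow_nonneg {ι : Type*} [Fintype ι] {K : Matrix ι ι ℝ}
    (hK : K.PosSemidef) (c : ι → ℝ) (n : ℕ) :
    0 ≤ ∑ p, ∑ q, c p * c q * K p q ^ (n + 1) := by
  have key : (Matrix.of fun p q => K p q ^ (n + 1)).PosSemidef := by
    induction n with
    | zero =>
      have e : (Matrix.of fun p q => K p q ^ (0 + 1)) = K := by ext; simp
      rwa [e]
    | succ n ih =>
      have e : (Matrix.of fun p q => K p q ^ (n + 1 + 1)) =
          (Matrix.of fun p q => K p q ^ (n + 1)) ⊙ K := by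
        ext; simp [pow_succ]
      rw [e]
      exact ih.hadamard hK
  have h := (Matrix.posSemidef_iff_dotProduct_mulVec.1 key).2 c
  simp only [dotProduct, mulVec, Finset.mul_sum, Matrix.of_apply, star_trivial] at h
  exact h.trans_eq (Finset.sum_congr rfl fun p _ => Finset.sum_congr rfl fun q _ => by ring)

theorem sum_smul_dotProduct_sum_smul {m ι κ : Type*} [Fintype m] [Fintype ι] [Fintype κ]
    (a : ι → ℝ) (b : κ → ℝ) (t : ι → m → ℝ) (r : κ → m → ℝ) :
    (∑ i, a i • t i) ⬝ᵥ (∑ j, b j • r j) = ∑ i, ∑ j, a i * ((t i ⬝ᵥ r j) * b j) := by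
  rw [sum_dotProduct]
  refine Finset.sum_congr rfl fun i _ => ?_
  rw [dotProduct_sum]
  refine Finset.sum_congr rfl fun j _ => ?_
  rw [smul_dotProduct, dotProduct_smul, smul_eq_mul, smul_eq_mul]
  ring

theorem inner_sum_smul_sum_smul {H : Type*} [NormedAddCommGroup H] [InnerProductSpace ℝ H]
    {ι κ : Type*} [Fintype ι] [Fintype κ] (a : ι → ℝ) (b : κ → ℝ) (t : ι → H) (r : κ → H) :
    inner ℝ (∑ i, a i • t i) (∑ j, b j • r j) = ∑ i, ∑ j, a i * b j * inner ℝ (t i) (r j) := by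
  rw [sum_inner]
  refine Finset.sum_congr rfl fun i _ => ?_
  rw [inner_sum]
  refine Finset.sum_congr rfl fun j _ => ?_
  rw [real_inner_smul_left, real_inner_smul_right]
  ring

/-- Schur-product comparison of two Gram matrices with their cross matrix. -/
theorem two_mul_sum_cross_pow_le {m n ι κ : Type*} [Fintype m] [Fintype n] [Fintype ι] [Fintype κ]
    (R : Matrix m n ℝ) {σ : ℝ}
    (hR : ∀ t r, 0 ≤ σ * (t ⬝ᵥ t) + σ * (r ⬝ᵥ r) + 2 * (t ⬝ᵥ R *ᵥ r))
    (a : ι → ℝ) (b : κ → ℝ) (t : ι → m → ℝ) (r : κ → n → ℝ) (k : ℕ) :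
    2 * ∑ i, ∑ j, a i * b j * (t i ⬝ᵥ R *ᵥ r j) ^ (k + 1) ≤
      σ ^ (k + 1) * (∑ i, ∑ j, a i * a j * (t i ⬝ᵥ t j) ^ (k + 1) +
        ∑ i, ∑ j, b i * b j * (r i ⬝ᵥ r j) ^ (k + 1)) := by
  let K : Matrix (ι ⊕ κ) (ι ⊕ κ) ℝ :=
    fromBlocks (of fun i j => σ * (t i ⬝ᵥ t j)) (of fun i j => t i ⬝ᵥ R *ᵥ r j)
      (of fun i j => t j ⬝ᵥ R *ᵥ r i) (of fun i j => σ * (r i ⬝ᵥ r j))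
  have hK : K.PosSemidef := by
    refine Matrix.posSemidef_iff_dotProduct_mulVec.2 ⟨?_, fun x => ?_⟩
    · ext p q
      rcases p with p | p <;> rcases q with q | q <;>
        simp [K, Matrix.conjTranspose_apply, dotProduct_comm]
    · have h := hR (∑ i, x (.inl i) • t i) (∑ j, x (.inr j) • r j)
      refine h.trans_eq ?_
      have e : ∑ i, ∑ j, x (.inr i) * ((t j ⬝ᵥ R *ᵥ r i) * x (.inl j)) =
          ∑ i, ∑ j, x (.inl i) * ((t i ⬝ᵥ R *ᵥ r j) * x (.inr j)) := by
        rw [Finset.sum_comm]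
        exact Finset.sum_congr rfl fun i _ => Finset.sum_congr rfl fun j _ => by ring
      have e1 := sum_smul_dotProduct_sum_smul (fun i => x (.inl i)) (fun i => x (.inl i)) t t
      have e2 := sum_smul_dotProduct_sum_smul (fun i => x (.inr i)) (fun i => x (.inr i)) r r
      have e3 := sum_smul_dotProduct_sum_smul (fun i => x (.inl i)) (fun i => x (.inr i)) t
        (fun j => R *ᵥ r j)
      simp only [← mulVec_smul, ← mulVec_sum] at e3
      rw [e1, e2, e3]
      have e4 : star x ⬝ᵥ K *ᵥ x = ∑ p, ∑ q, x p * (K p q * x q) := by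
        simp only [dotProduct, mulVec, Finset.mul_sum, star_trivial]
      rw [e4]
      simp only [Fintype.sum_sum_type, K, fromBlocks_apply₁₁,
        fromBlocks_apply₁₂, fromBlocks_apply₂₁, fromBlocks_apply₂₂, of_apply,
        Finset.sum_add_distrib, e]
      simp only [mul_assoc, mul_left_comm _ σ, ← Finset.mul_sum]
      ring
  have h := hK.sum_mul_pow_nonneg (Sum.elim a (-b)) k
  simp only [Fintype.sum_sum_type, K, fromBlocks_apply₁₁,
    fromBlocks_apply₁₂, fromBlocks_apply₂₁, fromBlocks_apply₂₂, of_apply, Sum.elim_inl,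
    Sum.elim_inr, Pi.neg_apply, Finset.sum_add_distrib] at h
  have e : ∑ i, ∑ j, -b i * a j * (t j ⬝ᵥ R *ᵥ r i) ^ (k + 1) =
      - ∑ i, ∑ j, a i * b j * (t i ⬝ᵥ R *ᵥ r j) ^ (k + 1) := by
    rw [Finset.sum_comm]
    simp only [← Finset.sum_neg_distrib]
    exact Finset.sum_congr rfl fun i _ => Finset.sum_congr rfl fun j _ => by ring
  rw [e] at h
  simp only [mul_neg, neg_mul, Finset.sum_neg_distrib, neg_neg, mul_pow, mul_left_comm _ (σ ^ (k+1)),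
    ← Finset.mul_sum] at h
  linarith

theorem sum_mul_dotProduct_pow_nonneg {l ι : Type*} [Fintype l] [Fintype ι] (w : ι → l → ℝ)
    (c : ι → ℝ) (k : ℕ) : 0 ≤ ∑ i, ∑ j, c i * c j * (w i ⬝ᵥ w j) ^ (k + 1) :=
  Matrix.PosSemidef.sum_mul_pow_nonneg (K := of w * (of w)ᴴ)
    (posSemidef_self_mul_conjTranspose (of w)) c k

theorem hasSum_sum_mul_exp_sub_one {ι κ : Type*} [Fintype ι] [Fintype κ] (c : ι → ℝ) (d : κ → ℝ)
    (x : ι → κ → ℝ) :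
    HasSum (fun k : ℕ => (∑ i, ∑ j, c i * d j * x i j ^ (k + 1)) * ((k + 1).factorial : ℝ)⁻¹)
      (∑ i, ∑ j, c i * d j * (Real.exp (x i j) - 1)) := by
  have hexp : ∀ x : ℝ, HasSum (fun k : ℕ => x ^ (k + 1) * ((k + 1).factorial : ℝ)⁻¹)
      (Real.exp x - 1) := by
    intro x
    have h := NormedSpace.expSeries_div_hasSum_exp x
    rw [← Real.exp_eq_exp_ℝ] at h
    simpa [div_eq_mul_inv] using (hasSum_nat_add_iff' 1).2 h
  simp only [Finset.sum_mul, mul_assoc]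
  exact hasSum_sum fun i _ => hasSum_sum fun j _ => ((hexp _).mul_left _).mul_left _

theorem sum_mul_exp_sub_one_le {m n ι κ : Type*} [Fintype m] [Fintype n] [Fintype ι] [Fintype κ]
    (R : Matrix m n ℝ) {σ : ℝ} (hσ0 : 0 ≤ σ) (hσ1 : σ ≤ 1)
    (hR : ∀ t r, 0 ≤ σ * (t ⬝ᵥ t) + σ * (r ⬝ᵥ r) + 2 * (t ⬝ᵥ R *ᵥ r))
    (a : ι → ℝ) (b : κ → ℝ) (t : ι → m → ℝ) (r : κ → n → ℝ) :
    2 * ∑ i, ∑ j, a i * b j * (Real.exp (t i ⬝ᵥ R *ᵥ r j) - 1) ≤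
      σ * (∑ i, ∑ j, a i * a j * (Real.exp (t i ⬝ᵥ t j) - 1) +
        ∑ i, ∑ j, b i * b j * (Real.exp (r i ⬝ᵥ r j) - 1)) := by
  refine hasSum_le (fun k => ?_)
    ((hasSum_sum_mul_exp_sub_one a b fun i j => t i ⬝ᵥ R *ᵥ r j).mul_left 2)
    (((hasSum_sum_mul_exp_sub_one a a fun i j => t i ⬝ᵥ t j).add
      (hasSum_sum_mul_exp_sub_one b b fun i j => r i ⬝ᵥ r j)).mul_left σ)
  have h1 := two_mul_sum_cross_pow_le R hR a b t r k
  have h2 := add_nonneg (sum_mul_dotProduct_pow_nonneg t a k) (sum_mul_dotProduct_pow_nonneg r b k)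
  have h3 : σ ^ (k + 1) ≤ σ := pow_le_of_le_one hσ0 hσ1 (by simp)
  rw [← add_mul, ← mul_assoc, ← mul_assoc]
  exact mul_le_mul_of_nonneg_right (h1.trans (mul_le_mul_of_nonneg_right h3 h2)) (by positivity)

/-- Two families in a Hilbert space with exponential Gram kernels, cross kernel
`exp (t ⬝ᵥ R *ᵥ r)` and unit inner products against `e`: the covariance bound on their closed
spans. -/
theorem inner_sub_le_of_exp_kernel {H : Type*} [NormedAddCommGroup H] [InnerProductSpace ℝ H]
    {m n : Type*} [Fintype m] [Fintype n]
    (R : Matrix m n ℝ) {σ : ℝ} (hσ0 : 0 ≤ σ) (hσ1 : σ ≤ 1)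
    (hR : ∀ t r, 0 ≤ σ * (t ⬝ᵥ t) + σ * (r ⬝ᵥ r) + 2 * (t ⬝ᵥ R *ᵥ r))
    (E : (m → ℝ) → H) (F : (n → ℝ) → H) (e : H)
    (hEE : ∀ t t', inner ℝ (E t) (E t') = Real.exp (t ⬝ᵥ t'))
    (hFF : ∀ r r', inner ℝ (F r) (F r') = Real.exp (r ⬝ᵥ r'))
    (hEF : ∀ t r, inner ℝ (E t) (F r) = Real.exp (t ⬝ᵥ R *ᵥ r))
    (hE : ∀ t, inner ℝ (E t) e = 1) (hF : ∀ r, inner ℝ (F r) e = 1) {u v : H}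
    (hu : u ∈ (Submodule.span ℝ (Set.range E)).topologicalClosure)
    (hv : v ∈ (Submodule.span ℝ (Set.range F)).topologicalClosure) :
    2 * (inner ℝ u v - inner ℝ u e * inner ℝ v e) ≤
      σ * ((inner ℝ u u - inner ℝ u e ^ 2) + (inner ℝ v v - inner ℝ v e ^ 2)) := by
  have hclosed : IsClosed {p : H × H | 2 * (inner ℝ p.1 p.2 - inner ℝ p.1 e * inner ℝ p.2 e) ≤
      σ * ((inner ℝ p.1 p.1 - inner ℝ p.1 e ^ 2) + (inner ℝ p.2 p.2 - inner ℝ p.2 e ^ 2))} :=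
    isClosed_le (by fun_prop) (by fun_prop)
  have hmem : (u, v) ∈ closure ((Submodule.span ℝ (Set.range E) : Set H) ×ˢ
      (Submodule.span ℝ (Set.range F) : Set H)) := by
    rw [closure_prod_eq]; exact ⟨hu, hv⟩
  refine closure_minimal ?_ hclosed hmem
  rintro ⟨u, v⟩ ⟨hu, hv⟩
  obtain ⟨p, a, t, rfl⟩ := Submodule.mem_span_set'.1 hu
  obtain ⟨q, b, r, rfl⟩ := Submodule.mem_span_set'.1 hv
  choose t' ht using fun i => (t i).2
  choose r' hr using fun i => (r i).2
  have hsum : ∀ {k l : ℕ} (c : Fin k → ℝ) (d : Fin l → ℝ) (x : Fin k → Fin l → ℝ),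
      ∑ i, ∑ j, c i * d j * (x i j - 1) =
        ∑ i, ∑ j, c i * d j * x i j - (∑ i, c i) * ∑ j, d j := by
    intro k l c d x
    simp only [mul_sub, mul_one, Finset.sum_sub_distrib, Finset.sum_mul_sum]
  have h := sum_mul_exp_sub_one_le R hσ0 hσ1 hR a b t' r'
  rw [hsum, hsum, hsum] at h
  have hEe : inner ℝ (∑ i, a i • E (t' i)) e = ∑ i, a i := by
    simp [sum_inner, real_inner_smul_left, hE]
  have hFe : inner ℝ (∑ i, b i • F (r' i)) e = ∑ i, b i := by
    simp [sum_inner, real_inner_smul_left, hF]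
  simp only [Set.mem_ofPred_eq, ← ht, ← hr, inner_sum_smul_sum_smul, hEe, hFe, hEE, hFF, hEF,
    pow_two]
  exact h

/-- A square-integrable function orthogonal to all exponentials `x ↦ exp (t ⬝ᵥ x)` vanishes. -/
theorem ae_eq_zero_of_forall_integral_exp_mul_eq_zero {m : Type*} [Fintype m]
    {ν : Measure (m → ℝ)} [IsFiniteMeasure ν]
    (hexp : ∀ t : m → ℝ, MemLp (fun x => Real.exp (t ⬝ᵥ x)) 2 ν) {h : (m → ℝ) → ℝ}
    (hh : MemLp h 2 ν) (h0 : ∀ t : m → ℝ, ∫ x, Real.exp (t ⬝ᵥ x) * h x ∂ν = 0) :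
    h =ᵐ[ν] 0 := by
  have hint : Integrable h ν := hh.integrable (by norm_num)
  have hprod : ∀ t : m → ℝ, Integrable (fun x => Real.exp (t ⬝ᵥ x) * h x) ν := fun t =>
    (hexp t).integrable_mul hh
  have hpos : ∀ g : (m → ℝ) → ℝ, MemLp g 2 ν → ∀ t : m → ℝ,
      Integrable (fun x => Real.exp (t ⬝ᵥ x)) (ν.withDensity fun x => ENNReal.ofReal (g x)) ∧
      ∫ x, Real.exp (t ⬝ᵥ x) ∂(ν.withDensity fun x => ENNReal.ofReal (g x)) =
        ∫ x, max (g x) 0 * Real.exp (t ⬝ᵥ x) ∂ν := by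
    intro g hg t
    have hm : AEMeasurable (fun x => ENNReal.ofReal (g x)) ν :=
      hg.aestronglyMeasurable.aemeasurable.ennreal_ofReal
    constructor
    · rw [integrable_withDensity_iff_integrable_smul₀' hm (by simp)]
      simp only [ENNReal.toReal_ofReal', smul_eq_mul]
      exact hg.pos_part.integrable_mul (hexp t)
    · rw [integral_withDensity_eq_integral_toReal_smul₀ hm (by simp)]
      simp only [ENNReal.toReal_ofReal', smul_eq_mul]
  set ν₁ := ν.withDensity fun x => ENNReal.ofReal (h x) with hν₁
  set ν₂ := ν.withDensity fun x => ENNReal.ofReal ((-h) x) with hν₂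
  have : IsFiniteMeasure ν₁ := isFiniteMeasure_withDensity_ofReal hint.2
  have : IsFiniteMeasure ν₂ := isFiniteMeasure_withDensity_ofReal hint.neg.2
  have hmgf : ∀ t : m → ℝ, ∫ x, Real.exp (t ⬝ᵥ x) ∂ν₁ = ∫ x, Real.exp (t ⬝ᵥ x) ∂ν₂ := by
    intro t
    rw [(hpos h hh t).2, (hpos (-h) hh.neg t).2, ← sub_eq_zero, ← integral_sub]
    · refine Eq.trans ?_ (h0 t)
      congr 1 with x
      rw [← sub_mul, mul_comm]
      congr 1
      exact max_zero_sub_max_neg_zero_eq_self (h x)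
    · exact hh.pos_part.integrable_mul (hexp t)
    · exact hh.neg.pos_part.integrable_mul (hexp t)
  have hlin : ∀ L : StrongDual ℝ (m → ℝ), ∃ t : m → ℝ, ∀ x, L x = t ⬝ᵥ x := by
    intro L
    classical
    refine ⟨fun i => L (Pi.single i 1), fun x => ?_⟩
    have := LinearMap.pi_apply_eq_sum_univ L.toLinearMap x
    simp only [ContinuousLinearMap.coe_coe, smul_eq_mul] at this
    rw [this]
    simp only [dotProduct]
    refine Finset.sum_congr rfl fun i _ => ?_
    rw [mul_comm]
    congr 2
    ext j
    simp [Pi.single_apply, eq_comm]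
  have heq : ν₁ = ν₂ := by
    refine Measure.ext_of_charFunDual (funext fun L => ?_)
    obtain ⟨t, ht⟩ := hlin L
    have hmgf' : mgf L ν₁ = mgf L ν₂ := by
      funext s
      have := hmgf (s • t)
      simpa [mgf, ht, smul_dotProduct] using this
    have huniv : integrableExpSet L ν₁ = Set.univ := by
      refine Set.eq_univ_of_forall fun s => ?_
      have := (hpos h hh (s • t)).1
      simpa [integrableExpSet, ht, smul_dotProduct] using this
    have hzero : ν₁ = 0 ↔ ν₂ = 0 := by
      have := hmgf 0
      simp only [zero_dotProduct, Real.exp_zero, integral_const, smul_eq_mul, mul_one] at this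
      rw [← Measure.measure_univ_eq_zero, ← Measure.measure_univ_eq_zero,
        ← measureReal_eq_zero_iff, ← measureReal_eq_zero_iff, this]
    have := eqOn_complexMGF_of_mgf' hmgf' hzero (x := Complex.I) (by simp [huniv])
    simpa [complexMGF, charFunDual_apply, mul_comm] using this
  rw [hν₁, hν₂, withDensity_eq_iff hint.aemeasurable.ennreal_ofReal
    hint.neg.aemeasurable.ennreal_ofReal hint.lintegral_lt_top.ne] at heq
  filter_upwards [heq] with x hx
  have := congrArg ENNReal.toReal hx
  simp only [ENNReal.toReal_ofReal', Pi.neg_apply] at this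
  rw [Pi.zero_apply, ← max_zero_sub_max_neg_zero_eq_self (h x), this, sub_self]

/-- Scaled exponentials span a dense subspace of `L²`. -/
theorem topologicalClosure_span_exp_eq_top {m : Type*} [Fintype m]
    {ν : Measure (m → ℝ)} [IsFiniteMeasure ν]
    (hexp : ∀ t : m → ℝ, MemLp (fun x => Real.exp (t ⬝ᵥ x)) 2 ν) (C : (m → ℝ) → ℝ)
    (hC : ∀ t, C t ≠ 0) :
    (Submodule.span ℝ (Set.range fun t => ((hexp t).const_mul (C t)).toLp)).topologicalClosure
      = ⊤ := by
  rw [Submodule.topologicalClosure_eq_top_iff, Submodule.eq_bot_iff]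
  intro h hh
  rw [Lp.eq_zero_iff_ae_eq_zero]
  refine ae_eq_zero_of_forall_integral_exp_mul_eq_zero hexp (Lp.memLp h) fun t => ?_
  have h1 := (Submodule.mem_orthogonal _ _).1 hh _ (Submodule.subset_span ⟨t, rfl⟩)
  rw [L2.inner_def] at h1
  have h2 : ∫ x, C t * (Real.exp (t ⬝ᵥ x) * h x) ∂ν = 0 := by
    rw [← h1]
    refine integral_congr_ae ?_
    filter_upwards [((hexp t).const_mul (C t)).coeFn_toLp] with x hx
    rw [hx]
    simp only [RCLike.inner_apply, conj_trivial]
    ring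
  rw [integral_const_mul] at h2
  exact (mul_eq_zero.1 h2).resolve_left (hC t)

/-- If every eigenvalue of a symmetric real matrix is at most `c`, so is its Rayleigh quotient. -/
theorem Matrix.IsHermitian.dotProduct_mulVec_le {n : Type*} [Fintype n] {A : Matrix n n ℝ}
    (hA : A.IsHermitian) {c : ℝ} (hc : ∀ (t : ℝ) (v : n → ℝ), v ≠ 0 → A *ᵥ v = t • v → t ≤ c)
    (v : n → ℝ) : v ⬝ᵥ A *ᵥ v ≤ c * (v ⬝ᵥ v) := by
  classical
  have hB : (c • (1 : Matrix n n ℝ) - A).IsHermitian :=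
    (isHermitian_one.smul (IsSelfAdjoint.all c)).sub hA
  have hpos : (c • (1 : Matrix n n ℝ) - A).PosSemidef := by
    rw [hB.posSemidef_iff_eigenvalues_nonneg]
    intro i
    have h1 := hB.mulVec_eigenvectorBasis i
    have hne : (⇑(hB.eigenvectorBasis i) : n → ℝ) ≠ 0 := by
      intro h
      apply hB.eigenvectorBasis.orthonormal.ne_zero i
      ext j
      exact congrFun h j
    have := hc (c - hB.eigenvalues i) _ hne (by
      rw [sub_mulVec, smul_mulVec, one_mulVec] at h1
      rw [sub_smul, ← h1]
      abel)
    simp only [Pi.zero_apply]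
    linarith
  have h := hpos.dotProduct_mulVec_nonneg v
  rw [star_trivial, sub_mulVec, smul_mulVec, one_mulVec, dotProduct_sub, dotProduct_smul,
    smul_eq_mul] at h
  linarith

theorem toLp_comp_mem_topologicalClosure_span_exp {Ω : Type*} [MeasurableSpace Ω] {μ : Measure Ω}
    [IsFiniteMeasure μ] {m : Type*} [Fintype m] {X : Ω → m → ℝ} (hX : AEMeasurable X μ)
    (hexp : ∀ t : m → ℝ, MemLp (fun ω => Real.exp (t ⬝ᵥ X ω)) 2 μ) (C : (m → ℝ) → ℝ)
    (hC : ∀ t, C t ≠ 0) {f : (m → ℝ) → ℝ} (hf : Measurable f)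
    (hfX : MemLp (fun ω => f (X ω)) 2 μ) :
    hfX.toLp ∈ (Submodule.span ℝ
      (Set.range fun t => ((hexp t).const_mul (C t)).toLp)).topologicalClosure := by
  have hP : MeasurePreserving (hX.mk X) μ (μ.map (hX.mk X)) := hX.measurable_mk.measurePreserving μ
  set ν := μ.map (hX.mk X) with hν
  have hmap : ν = μ.map X := Measure.map_congr hX.ae_eq_mk.symm
  have hexp' : ∀ t : m → ℝ, MemLp (fun x => Real.exp (t ⬝ᵥ x)) 2 ν := fun t => by
    rw [hmap, memLp_map_measure_iff (by fun_prop) hX]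
    exact hexp t
  have hf' : MemLp f 2 ν := by
    rw [hmap, memLp_map_measure_iff hf.aestronglyMeasurable hX]
    exact hfX
  have hcomp : ∀ {g : (m → ℝ) → ℝ} (hg : MemLp g 2 ν) (hg' : MemLp (fun ω => g (X ω)) 2 μ),
      Lp.compMeasurePreservingₗᵢ ℝ _ hP hg.toLp = hg'.toLp := by
    intro g hg hg'
    refine MemLp.toLp_congr (hg.comp_measurePreserving hP) hg' ?_
    filter_upwards [hX.ae_eq_mk] with ω hω
    rw [Function.comp_apply, ← hω]
  have hmem : hf'.toLp ∈ (Submodule.span ℝ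
      (Set.range fun t => ((hexp' t).const_mul (C t)).toLp)).topologicalClosure := by
    rw [topologicalClosure_span_exp_eq_top hexp' C hC]
    trivial
  have h := Submodule.topologicalClosure_map
    (Lp.compMeasurePreservingₗᵢ ℝ _ hP).toContinuousLinearMap (Submodule.span ℝ
      (Set.range fun t => ((hexp' t).const_mul (C t)).toLp)) ⟨_, hmem, hcomp hf' hfX⟩
  rw [Submodule.map_span, ← Set.range_comp] at h
  have hfun : (fun t => ((hexp t).const_mul (C t)).toLp) =
      (Lp.compMeasurePreservingₗᵢ ℝ _ hP) ∘ fun t => ((hexp' t).const_mul (C t)).toLp :=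
    funext fun t => (hcomp ((hexp' t).const_mul (C t)) ((hexp t).const_mul (C t))).symm
  rw [hfun]
  exact h

theorem inner_toLp_toLp {Ω : Type*} [MeasurableSpace Ω] {μ : Measure Ω} {f g : Ω → ℝ}
    (hf : MemLp f 2 μ) (hg : MemLp g 2 μ) :
    inner ℝ hf.toLp hg.toLp = ∫ ω, f ω * g ω ∂μ := by
  rw [L2.inner_def]
  refine integral_congr_ae ?_
  filter_upwards [hf.coeFn_toLp, hg.coeFn_toLp] with ω h1 h2
  simp [h1, h2, mul_comm]

theorem integral_normalized_exp_mul {Ω : Type*} [MeasurableSpace Ω] {μ : Measure Ω} {U V : Ω → ℝ}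
    {a b c : ℝ} (h : ∫ ω, Real.exp (U ω + V ω) ∂μ = Real.exp ((a + b + 2 * c) / 2)) :
    ∫ ω, Real.exp (-a / 2) * Real.exp (U ω) * (Real.exp (-b / 2) * Real.exp (V ω)) ∂μ =
      Real.exp c := by
  have e : ∀ ω, Real.exp (-a / 2) * Real.exp (U ω) * (Real.exp (-b / 2) * Real.exp (V ω)) =
      Real.exp (-a / 2 + -b / 2) * Real.exp (U ω + V ω) := fun ω => by
    simp only [Real.exp_add]; ring
  simp only [e]
  rw [integral_const_mul, h, ← Real.exp_add]
  ring_nf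

/-- Covariance bound for functions of two vectors with Gaussian joint exponential moments. -/
theorem two_mul_integral_mul_le_of_exp_moments {Ω : Type*} [MeasurableSpace Ω] {μ : Measure Ω}
    [IsProbabilityMeasure μ] {m n : Type*} [Fintype m] [Fintype n]
    {X : Ω → m → ℝ} {Y : Ω → n → ℝ} (hX : AEMeasurable X μ) (hY : AEMeasurable Y μ)
    (hXint : ∀ t : m → ℝ, MemLp (fun ω => Real.exp (t ⬝ᵥ X ω)) 2 μ)
    (hYint : ∀ r : n → ℝ, MemLp (fun ω => Real.exp (r ⬝ᵥ Y ω)) 2 μ)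
    (R : Matrix m n ℝ)
    (hmom : ∀ t r, ∫ ω, Real.exp (t ⬝ᵥ X ω + r ⬝ᵥ Y ω) ∂μ =
      Real.exp ((t ⬝ᵥ t + r ⬝ᵥ r + 2 * (t ⬝ᵥ R *ᵥ r)) / 2))
    {σ : ℝ} (hσ0 : 0 ≤ σ) (hσ1 : σ ≤ 1)
    (hR : ∀ t r, 0 ≤ σ * (t ⬝ᵥ t) + σ * (r ⬝ᵥ r) + 2 * (t ⬝ᵥ R *ᵥ r))
    {f : (m → ℝ) → ℝ} {g : (n → ℝ) → ℝ} (hf : Measurable f) (hg : Measurable g)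
    (hfX : MemLp (fun ω => f (X ω)) 2 μ) (hgY : MemLp (fun ω => g (Y ω)) 2 μ)
    (hf0 : ∫ ω, f (X ω) ∂μ = 0) (hg0 : ∫ ω, g (Y ω) ∂μ = 0) :
    2 * ∫ ω, f (X ω) * g (Y ω) ∂μ ≤ σ * (∫ ω, f (X ω) ^ 2 ∂μ + ∫ ω, g (Y ω) ^ 2 ∂μ) := by
  have hu := toLp_comp_mem_topologicalClosure_span_exp hX hXint
    (fun t => Real.exp (-(t ⬝ᵥ t) / 2)) (fun t => Real.exp_ne_zero _) hf hfX
  have hv := toLp_comp_mem_topologicalClosure_span_exp hY hYint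
    (fun t => Real.exp (-(t ⬝ᵥ t) / 2)) (fun t => Real.exp_ne_zero _) hg hgY
  have h1 : MemLp (fun _ : Ω => (1 : ℝ)) 2 μ := memLp_const 1
  have hmX : ∀ t, ∫ ω, Real.exp (t ⬝ᵥ X ω) ∂μ = Real.exp ((t ⬝ᵥ t) / 2) := fun t => by
    simpa using hmom t 0
  have hmY : ∀ r, ∫ ω, Real.exp (r ⬝ᵥ Y ω) ∂μ = Real.exp ((r ⬝ᵥ r) / 2) := fun r => by
    simpa using hmom 0 r
  have key := inner_sub_le_of_exp_kernel R hσ0 hσ1 hR _ _ h1.toLp ?_ ?_ ?_ ?_ ?_ hu hv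
  · simp only [inner_toLp_toLp, mul_one, hf0, hg0] at key
    simpa [pow_two] using key
  · intro t t'
    rw [inner_toLp_toLp]
    refine integral_normalized_exp_mul ?_
    simp only [← add_dotProduct, hmX]
    rw [add_dotProduct, dotProduct_add, dotProduct_add, dotProduct_comm t' t]
    ring_nf
  · intro t t'
    rw [inner_toLp_toLp]
    refine integral_normalized_exp_mul ?_
    simp only [← add_dotProduct, hmY]
    rw [add_dotProduct, dotProduct_add, dotProduct_add, dotProduct_comm t' t]
    ring_nf
  · intro t r
    rw [inner_toLp_toLp]
    exact integral_normalized_exp_mul (hmom t r)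
  · intro t
    rw [inner_toLp_toLp]
    simp only [mul_one]
    rw [integral_const_mul, hmX, ← Real.exp_add, neg_div, neg_add_cancel, Real.exp_zero]
  · intro t
    rw [inner_toLp_toLp]
    simp only [mul_one]
    rw [integral_const_mul, hmY, ← Real.exp_add, neg_div, neg_add_cancel, Real.exp_zero]

theorem integral_dotProduct_mul_dotProduct_s5 {Ω : Type*} [MeasurableSpace Ω] {μ : Measure Ω}
    {m n : Type*} [Fintype m] [Fintype n] {X : Ω → m → ℝ} {Y : Ω → n → ℝ}
    (hX : ∀ i, MemLp (fun ω => X ω i) 2 μ) (hY : ∀ j, MemLp (fun ω => Y ω j) 2 μ)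
    (M : Matrix m n ℝ) (hM : ∀ i j, ∫ ω, X ω i * Y ω j ∂μ = M i j) (t : m → ℝ) (r : n → ℝ) :
    ∫ ω, (t ⬝ᵥ X ω) * (r ⬝ᵥ Y ω) ∂μ = t ⬝ᵥ M *ᵥ r := by
  have hint : ∀ i j, Integrable (fun ω => t i * r j * (X ω i * Y ω j)) μ := fun i j =>
    ((hX i).integrable_mul (hY j)).const_mul _
  have e : ∀ ω, (t ⬝ᵥ X ω) * (r ⬝ᵥ Y ω) = ∑ i, ∑ j, t i * r j * (X ω i * Y ω j) := fun ω => by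
    simp only [dotProduct, Finset.sum_mul_sum]
    exact Finset.sum_congr rfl fun i _ => Finset.sum_congr rfl fun j _ => by ring
  simp only [e]
  rw [integral_finsetSum _ fun i _ => integrable_finsetSum _ fun j _ => hint i j]
  simp only [dotProduct, mulVec, Finset.mul_sum]
  refine Finset.sum_congr rfl fun i _ => ?_
  rw [integral_finsetSum _ fun j _ => hint i j]
  refine Finset.sum_congr rfl fun j _ => ?_
  rw [integral_const_mul, hM]
  ring

theorem memLp_two_of_map_eq_gaussianReal {Ω : Type*} [MeasurableSpace Ω] {μ : Measure Ω}
    {Z : Ω → ℝ} {v : ℝ≥0} (hZ : μ.map Z = gaussianReal 0 v) : MemLp Z 2 μ := by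
  have hm : AEMeasurable Z μ := aemeasurable_of_map_neZero (by rw [hZ]; infer_instance)
  have h := memLp_id_gaussianReal' (μ := 0) (v := v) 2 (by simp)
  rw [← hZ, memLp_map_measure_iff (by fun_prop) hm] at h
  exact h

theorem memLp_exp_of_map_eq_gaussianReal {Ω : Type*} [MeasurableSpace Ω] {μ : Measure Ω}
    {Z : Ω → ℝ} {v : ℝ≥0} (hZ : μ.map Z = gaussianReal 0 v) :
    MemLp (fun ω => Real.exp (Z ω)) 2 μ := by
  have hm : AEMeasurable Z μ := aemeasurable_of_map_neZero (by rw [hZ]; infer_instance)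
  rw [memLp_two_iff_integrable_sq (by fun_prop)]
  have h := integrable_exp_mul_gaussianReal (μ := 0) (v := v) 2
  rw [← hZ, integrable_map_measure (by fun_prop) hm] at h
  refine h.congr (.of_forall fun ω => ?_)
  simp [← Real.exp_nat_mul]

theorem integral_exp_of_map_eq_gaussianReal {Ω : Type*} [MeasurableSpace Ω] {μ : Measure Ω}
    {Z : Ω → ℝ} {v : ℝ≥0} (hZ : μ.map Z = gaussianReal 0 v) :
    ∫ ω, Real.exp (Z ω) ∂μ = Real.exp ((∫ ω, Z ω ^ 2 ∂μ) / 2) := by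
  have hm : AEMeasurable Z μ := aemeasurable_of_map_neZero (by rw [hZ]; infer_instance)
  have h := mgf_gaussianReal hZ 1
  have hv : ∫ ω, Z ω ^ 2 ∂μ = v := by
    have h2 := variance_of_integral_eq_zero (μ := gaussianReal 0 v) (X := id) (by fun_prop)
      (by simp)
    rw [variance_id_gaussianReal, ← hZ, integral_map hm (by fun_prop)] at h2
    simpa using h2.symm
  simpa [mgf, hv] using h

theorem le_mul_sqrt_mul_sqrt_of_forall {s A B C : ℝ} (hA : 0 ≤ A) (hB : 0 ≤ B)
    (h : ∀ x y : ℝ, 2 * (x * y * C) ≤ s * (x ^ 2 * A + y ^ 2 * B)) :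
    C ≤ s * √A * √B := by
  rcases hA.eq_or_lt with rfl | hA'
  · by_contra! hC
    simp only [Real.sqrt_zero, mul_zero, zero_mul] at hC
    have h1 := h ((s * B + 1) / (2 * C)) 1
    have h2 : 2 * ((s * B + 1) / (2 * C) * 1 * C) = s * B + 1 := by field_simp
    linarith
  rcases hB.eq_or_lt with rfl | hB'
  · by_contra! hC
    simp only [Real.sqrt_zero, mul_zero] at hC
    have h1 := h 1 ((s * A + 1) / (2 * C))
    have h2 : 2 * (1 * ((s * A + 1) / (2 * C)) * C) = s * A + 1 := by field_simp
    linarith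
  have h1 := h (√B) (√A)
  rw [Real.sq_sqrt hA, Real.sq_sqrt hB] at h1
  have hp : 0 < √A * √B := mul_pos (Real.sqrt_pos.2 hA') (Real.sqrt_pos.2 hB')
  have e : A * B = (√A * √B) * (√A * √B) := by
    rw [mul_mul_mul_comm, Real.mul_self_sqrt hA, Real.mul_self_sqrt hB]
  refine le_of_mul_le_mul_left ?_ hp
  have e' : √A * √B * (s * √A * √B) = s * (A * B) := by rw [e]; ring
  linarith

theorem dotProduct_mulVec_bound_of_sq_le {m n : Type*} [Fintype m] [Fintype n] (R : Matrix m n ℝ)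
    {σ : ℝ} (hσ : 0 ≤ σ) (h : ∀ r, (R *ᵥ r) ⬝ᵥ (R *ᵥ r) ≤ σ ^ 2 * (r ⬝ᵥ r)) (t : m → ℝ)
    (r : n → ℝ) : 0 ≤ σ * (t ⬝ᵥ t) + σ * (r ⬝ᵥ r) + 2 * (t ⬝ᵥ R *ᵥ r) := by
  have h1 := h r
  rcases hσ.eq_or_lt with rfl | hσ'
  · have h0 : R *ᵥ r = 0 := by
      refine dotProduct_self_eq_zero.1 (le_antisymm (by simpa using h1) ?_)
      exact Finset.sum_nonneg fun i _ => mul_self_nonneg _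
    simp [h0]
  · have h2 : 0 ≤ (σ • t + R *ᵥ r) ⬝ᵥ (σ • t + R *ᵥ r) :=
      Finset.sum_nonneg fun i _ => mul_self_nonneg _
    simp only [add_dotProduct, dotProduct_add, smul_dotProduct, dotProduct_smul, smul_eq_mul] at h2
    rw [dotProduct_comm (R *ᵥ r) t] at h2
    refine nonneg_of_mul_nonneg_right (b := _) ?_ hσ'
    nlinarith

theorem mulVec_dotProduct_mulVec_self {m n : Type*} [Fintype m] [Fintype n] (R : Matrix m n ℝ)
    (r : n → ℝ) : (R *ᵥ r) ⬝ᵥ (R *ᵥ r) = r ⬝ᵥ (Rᵀ * R) *ᵥ r := by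
  rw [← mulVec_mulVec, dotProduct_mulVec r, vecMul_transpose]

theorem IsJointGaussianFamily.map_dotProduct_add_dotProduct {Ω : Type*} [MeasurableSpace Ω]
    {μ : Measure Ω} {N : ℕ} {d : Fin N → ℕ} {Y : (α : Fin N) → Ω → Fin (d α) → ℝ}
    (h : IsJointGaussianFamily μ Y) (α β : Fin N) (t : Fin (d α) → ℝ) (r : Fin (d β) → ℝ) :
    ∃ v : ℝ≥0, μ.map (fun ω => t ⬝ᵥ Y α ω + r ⬝ᵥ Y β ω) = gaussianReal 0 v := by
  obtain ⟨v, hv⟩ := h (Pi.single α t + Pi.single β r)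
  have hsingle : ∀ (α : Fin N) (t : Fin (d α) → ℝ) (ω : Ω),
      ∑ γ, ∑ i, (Pi.single α t : (γ : Fin N) → Fin (d γ) → ℝ) γ i * Y γ ω i = t ⬝ᵥ Y α ω := by
    intro α t ω
    rw [Finset.sum_eq_single α]
    · simp [dotProduct]
    · intro γ _ hγ
      simp [Pi.single_eq_of_ne hγ]
    · simp
  refine ⟨v, hv ▸ ?_⟩
  congr 1
  funext ω
  simp only [Pi.add_apply, add_mul, Finset.sum_add_distrib, hsingle]

/-- If `Rᵀ R` has the eigenvalue `s ^ 2`, it is at most any bound for the eigenvalues of `R Rᵀ`. -/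
theorem le_of_eigenvalue_transpose_mul {m n : Type*} [Fintype m] [Fintype n] (R : Matrix m n ℝ)
    {s s' : ℝ} (hs' : 0 ≤ s')
    (h : ∃ v : n → ℝ, v ≠ 0 ∧ (Rᵀ * R) *ᵥ v = s ^ 2 • v)
    (hmax : ∀ (t : ℝ) (v : m → ℝ), v ≠ 0 → (R * Rᵀ) *ᵥ v = t • v → t ≤ s' ^ 2) : s ≤ s' := by
  rcases eq_or_ne s 0 with rfl | hs
  · exact hs'
  obtain ⟨v, hv, hev⟩ := h
  refine le_of_sq_le_sq (hmax _ (R *ᵥ v) ?_ ?_) hs'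
  · intro h0
    rw [← mulVec_mulVec, h0, mulVec_zero] at hev
    exact (smul_ne_zero (pow_ne_zero 2 hs) hv) hev.symm
  · rw [← mulVec_mulVec, mulVec_mulVec v, hev, mulVec_smul]

end

/-- **Upper decoupling bound for N Gaussian vectors.** For jointly Gaussian standard Gaussian
vectors `Y 1, …, Y N` with cross-correlation matrices `R α β`, largest singular values `s α β`
(with `s α α = 0`) and `σ₀` the largest eigenvalue of the matrix `(s α β)`, one has
`‖∑ φ α (Y α)‖₂² ≤ (1 + σ₀) ∑ ‖φ α (Y α)‖₂²` for all measurable centered square-integrable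
`φ α (Y α)`. -/
theorem decoupling_N_gaussian_vectors_upper
    {Ω : Type*} [MeasurableSpace Ω] (μ : Measure Ω) [IsProbabilityMeasure μ]
    {N : ℕ} {d : Fin N → ℕ} (Y : (α : Fin N) → Ω → Fin (d α) → ℝ)
    (hGauss : IsJointGaussianFamily μ Y)
    (hmean : ∀ α i, ∫ ω, Y α ω i ∂μ = 0)
    (hcov : ∀ α i j, ∫ ω, Y α ω i * Y α ω j ∂μ = if i = j then 1 else 0)
    (R : (α β : Fin N) → Matrix (Fin (d α)) (Fin (d β)) ℝ)
    (hR : ∀ α β, α ≠ β → ∀ i j, R α β i j = ∫ ω, Y α ω i * Y β ω j ∂μ)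
    (s : Fin N → Fin N → ℝ)
    (hsdiag : ∀ α, s α α = 0)
    (hs0 : ∀ α β, α ≠ β → 0 ≤ s α β)
    (hsEig : ∀ α β, α ≠ β → ∃ v : Fin (d β) → ℝ, v ≠ 0 ∧
      ((R α β).transpose * R α β).mulVec v = (s α β) ^ 2 • v)
    (hsMax : ∀ α β, α ≠ β → ∀ (t : ℝ) (v : Fin (d β) → ℝ), v ≠ 0 →
      ((R α β).transpose * R α β).mulVec v = t • v → t ≤ (s α β) ^ 2)
    (σ₀ : ℝ)
    (hσEig : ∃ v : Fin N → ℝ, v ≠ 0 ∧ (Matrix.of s).mulVec v = σ₀ • v)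
    (hσMax : ∀ (t : ℝ) (v : Fin N → ℝ), v ≠ 0 → (Matrix.of s).mulVec v = t • v → t ≤ σ₀)
    (φ : (α : Fin N) → (Fin (d α) → ℝ) → ℝ)
    (hmeas : ∀ α, Measurable (φ α))
    (hcent : ∀ α, ∫ ω, φ α (Y α ω) ∂μ = 0)
    (hL2 : ∀ α, Integrable (fun ω => (φ α (Y α ω)) ^ 2) μ) :
    ∫ ω, (∑ α, φ α (Y α ω)) ^ 2 ∂μ ≤ (1 + σ₀) * ∑ α, ∫ ω, (φ α (Y α ω)) ^ 2 ∂μ := by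
  open Matrix in
    have hlaw := hGauss.map_dotProduct_add_dotProduct
    have hlaw1 : ∀ α (t : Fin (d α) → ℝ), ∃ v : ℝ≥0,
        μ.map (fun ω => t ⬝ᵥ Y α ω) = gaussianReal 0 v := fun α t => by
      simpa using hlaw α α t 0
    have hYL2 : ∀ α i, MemLp (fun ω => Y α ω i) 2 μ := fun α i => by
      obtain ⟨v, hv⟩ := hlaw1 α (Pi.single i 1)
      simpa using memLp_two_of_map_eq_gaussianReal hv
    have hYm : ∀ α, AEMeasurable (Y α) μ := fun α =>
      aemeasurable_pi_iff.2 fun i => (hYL2 α i).aestronglyMeasurable.aemeasurable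
    have hexp : ∀ α (t : Fin (d α) → ℝ), MemLp (fun ω => Real.exp (t ⬝ᵥ Y α ω)) 2 μ :=
      fun α t => (hlaw1 α t).elim fun _ hv => memLp_exp_of_map_eq_gaussianReal hv
    have hφ : ∀ α, MemLp (fun ω => φ α (Y α ω)) 2 μ := fun α =>
      (memLp_two_iff_integrable_sq
        ((hmeas α).comp_aemeasurable (hYm α)).aestronglyMeasurable).2 (hL2 α)
    have hdot : ∀ α (t : Fin (d α) → ℝ), MemLp (fun ω => t ⬝ᵥ Y α ω) 2 μ :=
      fun α t => (hlaw1 α t).elim fun _ hv => memLp_two_of_map_eq_gaussianReal hv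
    have hsq : ∀ α β, α ≠ β → ∀ t r, ∫ ω, (t ⬝ᵥ Y α ω + r ⬝ᵥ Y β ω) ^ 2 ∂μ =
        t ⬝ᵥ t + r ⬝ᵥ r + 2 * (t ⬝ᵥ R α β *ᵥ r) := by
      intro α β hαβ t r
      have hself : ∀ γ (t : Fin (d γ) → ℝ), ∫ ω, (t ⬝ᵥ Y γ ω) * (t ⬝ᵥ Y γ ω) ∂μ = t ⬝ᵥ t :=
        fun γ t => by
          rw [integral_dotProduct_mul_dotProduct_s5 (hYL2 γ) (hYL2 γ) 1
            (fun i j => by rw [hcov, Matrix.one_apply]), Matrix.one_mulVec]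
      have hcross := integral_dotProduct_mul_dotProduct_s5 (hYL2 α) (hYL2 β) (R α β)
        (fun i j => (hR α β hαβ i j).symm) t r
      have e : ∀ ω, (t ⬝ᵥ Y α ω + r ⬝ᵥ Y β ω) ^ 2 = (t ⬝ᵥ Y α ω) * (t ⬝ᵥ Y α ω) +
          (r ⬝ᵥ Y β ω) * (r ⬝ᵥ Y β ω) + 2 * ((t ⬝ᵥ Y α ω) * (r ⬝ᵥ Y β ω)) := fun ω => by ring
      have hi : ∀ γ δ (t : Fin (d γ) → ℝ) (r : Fin (d δ) → ℝ),
          Integrable (fun ω => (t ⬝ᵥ Y γ ω) * (r ⬝ᵥ Y δ ω)) μ :=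
        fun γ δ t r => (hdot γ t).integrable_mul (hdot δ r)
      simp only [e]
      rw [integral_add ((hi α α t t).fun_add (hi β β r r)) ((hi α β t r).const_mul 2),
        integral_add (hi α α t t) (hi β β r r), integral_const_mul, hself, hself, hcross]
    have hRbound : ∀ α β, α ≠ β → ∀ r,
        (R α β *ᵥ r) ⬝ᵥ (R α β *ᵥ r) ≤ s α β ^ 2 * (r ⬝ᵥ r) := fun α β hαβ r => by
      rw [mulVec_dotProduct_mulVec_self]
      exact (isHermitian_conjTranspose_mul_self (R α β)).dotProduct_mulVec_le (hsMax α β hαβ) r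
    have hs1 : ∀ α β, α ≠ β → s α β ≤ 1 := by
      intro α β hαβ
      obtain ⟨v, hv, hev⟩ := hsEig α β hαβ
      have h1 := mulVec_dotProduct_mulVec_self (R α β) v
      rw [hev, dotProduct_smul, smul_eq_mul] at h1
      have h2 := hsq α β hαβ (-(R α β *ᵥ v)) v
      have h3 : 0 ≤ ∫ ω, (-(R α β *ᵥ v) ⬝ᵥ Y α ω + v ⬝ᵥ Y β ω) ^ 2 ∂μ :=
        integral_nonneg fun ω => sq_nonneg _
      rw [h2, neg_dotProduct_neg, neg_dotProduct, h1] at h3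
      have hpos : 0 < v ⬝ᵥ v := lt_of_le_of_ne
        (Finset.sum_nonneg fun i _ => mul_self_nonneg _)
        fun h => hv (dotProduct_self_eq_zero.1 h.symm)
      refine le_of_sq_le_sq ?_ zero_le_one
      refine le_of_mul_le_mul_right ?_ hpos
      linarith
    have hpair : ∀ α β, α ≠ β → ∫ ω, φ α (Y α ω) * φ β (Y β ω) ∂μ ≤
        s α β * √(∫ ω, φ α (Y α ω) ^ 2 ∂μ) * √(∫ ω, φ β (Y β ω) ^ 2 ∂μ) := by
      intro α β hαβ
      refine le_mul_sqrt_mul_sqrt_of_forall (integral_nonneg fun ω => sq_nonneg _)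
        (integral_nonneg fun ω => sq_nonneg _) fun x y => ?_
      have h := two_mul_integral_mul_le_of_exp_moments (hYm α) (hYm β) (hexp α) (hexp β) (R α β)
        (fun t r => by
          obtain ⟨v, hv⟩ := hlaw α β t r
          rw [integral_exp_of_map_eq_gaussianReal hv, hsq α β hαβ])
        (hs0 α β hαβ) (hs1 α β hαβ)
        (dotProduct_mulVec_bound_of_sq_le (R α β) (hs0 α β hαβ) (hRbound α β hαβ))
        ((hmeas α).const_mul x) ((hmeas β).const_mul y)
        ((hφ α).const_mul x) ((hφ β).const_mul y)
        (by rw [integral_const_mul, hcent, mul_zero]) (by rw [integral_const_mul, hcent, mul_zero])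
      simp only [mul_pow, mul_mul_mul_comm x, integral_const_mul] at h
      exact h
    have hsymm_le : ∀ α β, α ≠ β → s α β ≤ s β α := by
      intro α β hαβ
      have hT : R β α = (R α β)ᵀ := by
        ext i j
        rw [transpose_apply, hR β α hαβ.symm, hR α β hαβ]
        simp only [mul_comm]
      refine le_of_eigenvalue_transpose_mul (R α β) (hs0 β α hαβ.symm) (hsEig α β hαβ) ?_
      have h := hsMax β α hαβ.symm
      rwa [hT, transpose_transpose] at h
    have hS : (Matrix.of s).IsHermitian := by
      ext α β
      rcases eq_or_ne α β with rfl | hαβ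
      · rfl
      · exact le_antisymm (hsymm_le β α hαβ.symm) (hsymm_le α β hαβ)
    have hray := hS.dotProduct_mulVec_le hσMax fun α => √(∫ ω, φ α (Y α ω) ^ 2 ∂μ)
    simp only [dotProduct, mulVec, Matrix.of_apply, Finset.mul_sum] at hray
    have hterm : ∀ α β, ∫ ω, φ α (Y α ω) * φ β (Y β ω) ∂μ ≤
        (if α = β then ∫ ω, φ α (Y α ω) ^ 2 ∂μ else 0) +
        √(∫ ω, φ α (Y α ω) ^ 2 ∂μ) * (s α β * √(∫ ω, φ β (Y β ω) ^ 2 ∂μ)) := by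
      intro α β
      rcases eq_or_ne α β with rfl | hαβ
      · simp [hsdiag, pow_two]
      · rw [if_neg hαβ, zero_add]
        exact (hpair α β hαβ).trans_eq (by ring)
    have hint : ∀ α β, Integrable (fun ω => φ α (Y α ω) * φ β (Y β ω)) μ := fun α β =>
      (hφ α).integrable_mul (hφ β)
    calc ∫ ω, (∑ α, φ α (Y α ω)) ^ 2 ∂μ
        = ∑ α, ∑ β, ∫ ω, φ α (Y α ω) * φ β (Y β ω) ∂μ := by
          simp only [pow_two, Finset.sum_mul_sum]
          rw [integral_finsetSum _ fun α _ => integrable_finsetSum _ fun β _ => hint α β]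
          exact Finset.sum_congr rfl fun α _ => integral_finsetSum _ fun β _ => hint α β
      _ ≤ ∑ α, ∑ β, ((if α = β then ∫ ω, φ α (Y α ω) ^ 2 ∂μ else 0) +
            √(∫ ω, φ α (Y α ω) ^ 2 ∂μ) * (s α β * √(∫ ω, φ β (Y β ω) ^ 2 ∂μ))) :=
          Finset.sum_le_sum fun α _ => Finset.sum_le_sum fun β _ => hterm α β
      _ ≤ (1 + σ₀) * ∑ α, ∫ ω, φ α (Y α ω) ^ 2 ∂μ := by
          have hsqrt : ∀ α, √(∫ ω, φ α (Y α ω) ^ 2 ∂μ) * √(∫ ω, φ α (Y α ω) ^ 2 ∂μ) =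
              ∫ ω, φ α (Y α ω) ^ 2 ∂μ := fun α =>
            Real.mul_self_sqrt (integral_nonneg fun ω => sq_nonneg _)
          simp only [hsqrt] at hray
          simp only [Finset.sum_add_distrib, Finset.sum_ite_eq, Finset.mem_univ, if_true]
          rw [add_mul, one_mul]
          simpa [Finset.mul_sum] using hray
end
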